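/- arXiv:2604.27483 — 4 statements merged into one kernel-verified Lean document; each statement's English description precedes it below -/
import Mathlib

section
/- Let r and k be odd integers and λ a positive integer, and let λ* be the odd integer with λ* ∈ {λ, λ+1}. If (1/λ*)·r ≤ k ≤ r−2, then every λ-edge-connected r-regular multigraph G with k·|V(G)| even (equivalently, |V(G)| even) has a k-factor. -/
open Finset

/-! ### Multigraphs

A (finite, loopless) multigraph on a vertex type `V` is given by an edge-index type `ε`
together with an endpoint map `ends : ε → Sym2 V`; looplessness is the condition
`∀ e, ¬ (ends e).IsDiag`.  Multiple edges are allowed: distinct indices may have the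
same endpoints. -/

section Multigraph

variable {V : Type} [Fintype V] [DecidableEq V] {ε : Type} [Fintype ε]

/-- The degree of a vertex in a multigraph. -/
def mdeg (ends : ε → Sym2 V) (v : V) : ℕ :=
  (Finset.univ.filter fun e => v ∈ ends e).card

/-- The degree of a vertex in the spanning subgraph with edge set `F`. -/
def mdegIn (ends : ε → Sym2 V) (F : Finset ε) (v : V) : ℕ :=
  (F.filter fun e => v ∈ ends e).card

/-- `e_G(A, B)`: the number of edges with one endvertex in `A` and the other in `B`
(for disjoint `A`, `B`). -/
def eM (ends : ε → Sym2 V) (A B : Finset V) : ℕ :=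
  (Finset.univ.filter fun e => ∃ a ∈ A, ∃ b ∈ B, ends e = s(a, b)).card

/-- A multigraph is `r`-regular if every vertex has degree `r`. -/
def MRegular (ends : ε → Sym2 V) (r : ℕ) : Prop :=
  ∀ v : V, mdeg ends v = r

/-- A `k`-factor: a spanning subgraph (an edge set `F`) in which every vertex has degree `k`. -/
def HasKFactor (ends : ε → Sym2 V) (k : ℕ) : Prop :=
  ∃ F : Finset ε, ∀ v : V, mdegIn ends F v = k

/-- The multigraph restricted to the edge set `E'` is connected: every two vertices are
joined by a walk (equivalently, by a path). -/
def MConnected (ends : ε → Sym2 V) (E' : Finset ε) : Prop :=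
  ∀ u v : V, Relation.ReflTransGen (fun a b => ∃ e ∈ E', ends e = s(a, b)) u v

/-- A multigraph is `lam`-edge-connected if removing any set of at most `lam - 1`
edges leaves it connected. -/
def MEdgeConnected [DecidableEq ε] (ends : ε → Sym2 V) (lam : ℕ) : Prop :=
  ∀ F : Finset ε, F.card ≤ lam - 1 → MConnected ends (Finset.univ \ F)

/-- Reachability within the vertex set `A` (both endpoints of every step lie in `A`). -/
def MReachIn (ends : ε → Sym2 V) (A : Finset V) (u v : V) : Prop :=
  Relation.ReflTransGen (fun a b => a ∈ A ∧ b ∈ A ∧ ∃ e : ε, ends e = s(a, b)) u v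

open scoped Classical in
/-- `D` is (the vertex set of) a connected component of the subgraph of the multigraph
induced on the vertex set `A`. -/
def MIsComp (ends : ε → Sym2 V) (A D : Finset V) : Prop :=
  ∃ v ∈ A, D = A.filter (MReachIn ends A v)

/-- `q(S, T)`: the number of components `D` of `G - (S ∪ T)` with
`f(D) + e_G(D, T)` odd (the `f`-odd components). -/
noncomputable def qST (ends : ε → Sym2 V) (f : V → ℤ) (S T : Finset V) : ℕ :=
  Nat.card {D : Finset V // MIsComp ends (Finset.univ \ (S ∪ T)) D ∧
    Odd ((∑ v ∈ D, f v) + (eM ends D T : ℤ))}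

/-- `η(S, T) = f(S) + deg_G(T) − g(T) − e_G(S, T) − q(S, T)`. -/
noncomputable def eta (ends : ε → Sym2 V) (g f : V → ℤ) (S T : Finset V) : ℤ :=
  (∑ v ∈ S, f v) + (∑ v ∈ T, (mdeg ends v : ℤ)) - (∑ v ∈ T, g v)
    - (eM ends S T : ℤ) - (qST ends f S T : ℤ)

/-- A parity `(g, f)`-factor: a spanning subgraph `F` with
`g(v) ≤ deg_F(v) ≤ f(v)` and `deg_F(v) ≡ f(v) (mod 2)` for every vertex `v`. -/
def HasParityFactor (ends : ε → Sym2 V) (g f : V → ℤ) : Prop :=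
  ∃ F : Finset ε, ∀ v : V,
    g v ≤ (mdegIn ends F v : ℤ) ∧ (mdegIn ends F v : ℤ) ≤ f v ∧
      (mdegIn ends F v : ℤ) ≡ f v [ZMOD 2]

end Multigraph

/-! ### Hypergraphs

A hypergraph on a finite vertex type `V` is given by an edge-index type `ε` together with
a map `edges : ε → Finset V`; every edge is required to have at least two vertices
(a hypothesis in the theorems below).  Multiple edges are allowed: distinct indices may
carry the same vertex set. -/

section Hypergraph

variable {V : Type} [Fintype V] [DecidableEq V] {ε : Type} [Fintype ε]

/-- The degree of a vertex `v` in a hypergraph: the number of edges containing `v`. -/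
def hdeg (edges : ε → Finset V) (v : V) : ℕ :=
  (Finset.univ.filter fun e => v ∈ edges e).card

/-- `vs = [v₁, …, v_{l+1}]`, `es = [e₁, …, e_l]` form a Berge path (distinct vertices,
distinct edges, `{vᵢ, vᵢ₊₁} ⊆ eᵢ`) using hyperedges from `E'`. -/
def IsBergePath (edges : ε → Finset V) (E' : Finset ε) (vs : List V) (es : List ε) : Prop :=
  vs.Nodup ∧ es.Nodup ∧ vs.length = es.length + 1 ∧
  ∀ i : ℕ, (hi : i < es.length) → (hv : i + 1 < vs.length) →
    es[i] ∈ E' ∧ vs[i]'(Nat.lt_of_succ_lt hv) ∈ edges es[i] ∧ vs[i + 1] ∈ edges es[i]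

/-- The hypergraph restricted to the edge set `E'` is connected: every two vertices are
joined by a Berge path. -/
def HConnected (edges : ε → Finset V) (E' : Finset ε) : Prop :=
  ∀ u v : V, ∃ vs es, IsBergePath edges E' vs es ∧ vs.head? = some u ∧ vs.getLast? = some v

/-- A hypergraph is `lam`-edge-connected if removing any set of at most `lam - 1`
edges leaves it connected. -/
def HEdgeConnected [DecidableEq ε] (edges : ε → Finset V) (lam : ℕ) : Prop :=
  ∀ F : Finset ε, F.card ≤ lam - 1 → HConnected edges (Finset.univ \ F)

/-- A Berge `k`-factor of the hypergraph: a spanning subhypergraph (an edge set `E'`)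
which is Berge-`G` for some `k`-regular (multi)graph `G` on the same vertex set, i.e.
there are a loopless multigraph `G` (with edge-index type `Fin n` and endpoint map
`ends`) which is `k`-regular, and a bijection `φ` from the edges of `G` to `E'` such
that every edge of `G` is contained in the corresponding hyperedge. -/
def HasBergeKFactor (edges : ε → Finset V) (k : ℕ) : Prop :=
  ∃ (E' : Finset ε) (n : ℕ) (ends : Fin n → Sym2 V) (φ : Fin n ≃ {e // e ∈ E'}),
    (∀ g, ¬ (ends g).IsDiag) ∧
    (∀ v : V, (Finset.univ.filter fun g => v ∈ ends g).card = k) ∧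
    (∀ g : Fin n, ∀ x ∈ ends g, x ∈ edges (φ g).1)

/-- The incidence graph of a hypergraph: the bipartite simple graph on `V ⊕ ε` in which
a vertex `v` and a hyperedge `e` are adjacent iff `v ∈ e`. -/
def incGraph (edges : ε → Finset V) : SimpleGraph (V ⊕ ε) where
  Adj a b := (∃ v e, a = Sum.inl v ∧ b = Sum.inr e ∧ v ∈ edges e) ∨
             (∃ v e, a = Sum.inr e ∧ b = Sum.inl v ∧ v ∈ edges e)
  symm := by
    refine ⟨?_⟩
    rintro a b (⟨v, e, rfl, rfl, h⟩ | ⟨v, e, rfl, rfl, h⟩)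
    · exact Or.inr ⟨v, e, rfl, rfl, h⟩
    · exact Or.inl ⟨v, e, rfl, rfl, h⟩
  loopless := by
    refine ⟨?_⟩
    rintro a (⟨v, e, rfl, h, -⟩ | ⟨v, e, rfl, h, -⟩) <;> simp at h

end Hypergraph

/-! ### Simple graphs: edge counts, components, parity factors -/

section SimpleGraphAux

variable {W : Type} [Fintype W] [DecidableEq W]

open scoped Classical in
/-- The number of edges of a simple graph with one endvertex in `A` and the other in `B`
(for disjoint `A`, `B`). -/
noncomputable def eSG (G : SimpleGraph W) (A B : Finset W) : ℕ :=
  ((A ×ˢ B).filter fun p => G.Adj p.1 p.2).card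

/-- Reachability within the vertex set `A` in a simple graph. -/
def SReachIn (G : SimpleGraph W) (A : Finset W) (u v : W) : Prop :=
  Relation.ReflTransGen (fun a b => a ∈ A ∧ b ∈ A ∧ G.Adj a b) u v

open scoped Classical in
/-- `D` is (the vertex set of) a connected component of the subgraph induced on `A`. -/
def SIsComp (G : SimpleGraph W) (A D : Finset W) : Prop :=
  ∃ v ∈ A, D = A.filter (SReachIn G A v)

/-- A parity `(g, f)`-factor of a simple graph: a spanning subgraph `F` (a set of edges)
with `g(v) ≤ deg_F(v) ≤ f(v)` and `deg_F(v) ≡ f(v) (mod 2)` for every vertex `v`. -/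
def HasParityFactorSG (G : SimpleGraph W) (g f : W → ℤ) : Prop :=
  ∃ F : Finset (Sym2 W), (∀ x ∈ F, x ∈ G.edgeSet) ∧
    ∀ v : W, g v ≤ ((F.filter fun x => v ∈ x).card : ℤ) ∧
      ((F.filter fun x => v ∈ x).card : ℤ) ≤ f v ∧
      ((F.filter fun x => v ∈ x).card : ℤ) ≡ f v [ZMOD 2]

end SimpleGraphAux


/-- A fractional perfect matching with all odd cuts large gives a perfect matching. -/
theorem exists_pm_of_weights {W : Type} [Fintype W] [DecidableEq W] (G : SimpleGraph W)
    (w : W → W → ℕ) (R : ℕ) (hR : 0 < R)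
    (hadj : ∀ x y, w x y ≠ 0 → G.Adj x y)
    (hcol : ∀ y, ∑ x, w x y ≤ R)
    (hcut : ∀ C : Finset W, Odd C.card → R ≤ ∑ x ∈ C, ∑ y ∈ Cᶜ, w x y) :
    ∃ M : G.Subgraph, M.IsPerfectMatching := by
  classical
  rw [SimpleGraph.tutte]
  intro u hu
  unfold SimpleGraph.IsTutteViolator at hu
  set H := ((⊤ : G.Subgraph).deleteVerts u) with hH
  have hverts : ∀ x, x ∈ H.verts ↔ x ∉ u := by
    intro x; simp [hH]
  let S : H.coe.ConnectedComponent → Finset W := fun c =>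
    (Finset.univ.filter fun x => ∃ h : x ∈ H.verts, H.coe.connectedComponentMk ⟨x, h⟩ = c)
  have hSmem : ∀ c x, x ∈ S c ↔ ∃ h : x ∈ H.verts, H.coe.connectedComponentMk ⟨x, h⟩ = c := by
    intro c x; simp [S]
  have hScard : ∀ c, (S c).card = c.supp.ncard := by
    intro c
    have : (S c : Set W) = Subtype.val '' c.supp := by
      ext x
      simp only [Finset.mem_coe, hSmem, Set.mem_image, SimpleGraph.ConnectedComponent.mem_supp_iff,
        Subtype.exists, exists_and_right, exists_eq_right]
    rw [← Set.ncard_coe_finset, this, Set.ncard_image_of_injective _ Subtype.val_injective]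
  have hfin : H.coe.oddComponents.Finite := Set.toFinite _
  let O := hfin.toFinset
  have hO : O.card = H.coe.oddComponents.ncard := by
    rw [Set.ncard_eq_toFinset_card _ hfin]
  let U : Finset W := Finset.univ.filter (· ∈ u)
  have hU : U.card = u.ncard := by
    rw [← Set.ncard_coe_finset]; congr 1; ext x; simp [U]
  have hdisj : (O : Set H.coe.ConnectedComponent).PairwiseDisjoint S := by
    intro c _ d _ hcd
    rw [Function.onFun, Finset.disjoint_left]
    intro x hx hx'
    obtain ⟨h, e⟩ := (hSmem _ _).1 hx
    obtain ⟨h', e'⟩ := (hSmem _ _).1 hx'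
    exact hcd (e.symm.trans e')
  have h1 : ∀ c ∈ O, R ≤ ∑ x ∈ S c, ∑ y ∈ U, w x y := by
    intro c hc
    have hodd : Odd (S c).card := by
      rw [hScard]
      simpa [O] using hc
    refine (hcut _ hodd).trans (Finset.sum_le_sum fun x hx => ?_)
    refine Finset.sum_le_sum_of_ne_zero ?_
    intro y hy hne
    by_contra hyU
    have hyu : y ∉ u := by simpa [U] using hyU
    obtain ⟨h, e⟩ := (hSmem _ _).1 hx
    apply Finset.mem_compl.1 hy
    rw [hSmem]
    refine ⟨(hverts y).2 hyu, ?_⟩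
    rw [← e]
    apply SimpleGraph.ConnectedComponent.sound
    apply SimpleGraph.Adj.reachable
    have := hadj x y hne
    have hxu := (hverts x).1 h
    simp [hH, hxu, hyu, this.symm]
  have h2 : O.card * R ≤ ∑ c ∈ O, ∑ x ∈ S c, ∑ y ∈ U, w x y := by
    have := Finset.card_nsmul_le_sum O _ R h1
    simpa using this
  rw [← Finset.sum_biUnion hdisj, Finset.sum_comm] at h2
  have h3 : ∑ y ∈ U, ∑ x ∈ O.biUnion S, w x y ≤ U.card * R := by
    have := Finset.sum_le_card_nsmul U (fun y => ∑ x ∈ O.biUnion S, w x y) R (fun y _ =>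
      (Finset.sum_le_sum_of_subset (Finset.subset_univ _)).trans (hcol y))
    simpa using this
  have h4 := Nat.le_of_mul_le_mul_right (h2.trans h3) hR
  omega

theorem sum_le_cut {W ι : Type} [Fintype W] [DecidableEq W] [Fintype ι] (w : W → W → ℕ)
    (C : Finset W) (f : ι → W × W) (hf : Function.Injective f)
    (h1 : ∀ i, (f i).1 ∈ C) (h2 : ∀ i, (f i).2 ∉ C) :
    ∑ i, w (f i).1 (f i).2 ≤ ∑ x ∈ C, ∑ y ∈ Cᶜ, w x y := by
  classical
  rw [← Finset.sum_product' C Cᶜ]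
  rw [← Finset.sum_image (s := Finset.univ) (g := f) (f := fun p : W × W => w p.1 p.2)
    (fun a _ b _ h => hf h)]
  apply Finset.sum_le_sum_of_subset
  intro p hp
  obtain ⟨i, -, rfl⟩ := Finset.mem_image.1 hp
  simp [h1, h2]

set_option linter.unusedSectionVars false

section Gadget

variable {V : Type} [Fintype V] [DecidableEq V] {ε : Type} [Fintype ε] [DecidableEq ε]

/-- Half-edges. -/
abbrev HalfE (ends : ε → Sym2 V) := {p : V × ε // p.1 ∈ ends p.2}

/-- Weights on the gadget graph. -/
def gw (ends : ε → Sym2 V) (k m : ℕ) :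
    HalfE ends ⊕ (V × Fin m) → HalfE ends ⊕ (V × Fin m) → ℕ
  | .inl a, .inl b => if a.1.2 = b.1.2 ∧ a ≠ b then k else 0
  | .inl a, .inr b => if a.1.1 = b.1 then 1 else 0
  | .inr b, .inl a => if a.1.1 = b.1 then 1 else 0
  | .inr _, .inr _ => 0

theorem gw_symm (ends : ε → Sym2 V) (k m : ℕ) (x y) : gw ends k m x y = gw ends k m y x := by
  rcases x with a | b <;> rcases y with a' | b' <;> simp [gw, eq_comm]

/-- The gadget graph. -/
def gG (ends : ε → Sym2 V) (k m : ℕ) : SimpleGraph (HalfE ends ⊕ (V × Fin m)) where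
  Adj x y := gw ends k m x y ≠ 0
  symm := ⟨fun x y h => by rwa [gw_symm]⟩
  loopless := ⟨fun x => by rcases x with a | b <;> simp [gw]⟩

/-- The other half. -/
theorem exists_other (ends : ε → Sym2 V) (hl : ∀ e, ¬ (ends e).IsDiag) (a : HalfE ends) :
    ∃ a' : HalfE ends, a'.1.2 = a.1.2 ∧ a' ≠ a ∧
      ∀ c : HalfE ends, c.1.2 = a.1.2 → c = a ∨ c = a' := by
  obtain ⟨⟨v, e⟩, h⟩ := a
  obtain ⟨u, hu⟩ := h
  have huv : u ≠ v := by
    rintro rfl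
    exact hl e (by rw [hu]; simp)
  refine ⟨⟨(u, e), by simp only [] at hu ⊢; rw [hu]; simp⟩, rfl, ?_, ?_⟩
  · intro h
    exact huv (congrArg (fun z => z.1.1) h)
  · rintro ⟨⟨x, e'⟩, hx⟩ he
    simp only at he hx hu
    subst he
    have hx2 := hx
    rw [hu] at hx2
    rcases Sym2.mem_iff.1 hx2 with h | h
    · left; exact Subtype.ext (Prod.ext h rfl)
    · right; exact Subtype.ext (Prod.ext h rfl)

theorem card_half (ends : ε → Sym2 V) (r : ℕ) (hreg : MRegular ends r) (v : V) :
    (Finset.univ.filter fun a : HalfE ends => a.1.1 = v).card = r := by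
  rw [← hreg v, mdeg]
  refine Finset.card_bij (fun a _ => a.1.2) ?_ ?_ ?_
  · rintro ⟨⟨x, e⟩, h⟩ hx
    simp at hx h ⊢
    rwa [← hx]
  · rintro ⟨⟨x, e⟩, h⟩ hx ⟨⟨x', e'⟩, h'⟩ hx' he
    simp at hx hx' he ⊢
    exact ⟨hx.trans hx'.symm, he⟩
  · intro e he
    simp at he
    exact ⟨⟨(v, e), he⟩, by simp, rfl⟩

theorem gw_col (ends : ε → Sym2 V) (hl : ∀ e, ¬ (ends e).IsDiag) (r k m : ℕ) (hkm : k + m = r)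
    (hreg : MRegular ends r) (y) : ∑ x, gw ends k m x y ≤ r := by
  rw [Fintype.sum_sum_type]
  rcases y with a | b
  · obtain ⟨a', h1, h2, h3⟩ := exists_other ends hl a
    have e1 : ∑ x : HalfE ends, gw ends k m (.inl x) (.inl a) = k := by
      rw [Finset.sum_eq_single a']
      · simp [gw, h1, h2]
      · intro b _ hb
        by_cases hb' : b.1.2 = a.1.2
        · rcases h3 b hb' with rfl | rfl
          · simp [gw]
          · exact absurd rfl hb
        · simp [gw, hb']
      · simp
    have e2 : ∑ x : V × Fin m, gw ends k m (.inr x) (.inl a) = m := by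
      rw [Fintype.sum_prod_type]
      rw [Finset.sum_eq_single a.1.1]
      · simp [gw]
      · intro b _ hb
        simp [gw, hb.symm]
      · simp
    rw [e1, e2, hkm]
  · simp only [gw, Finset.sum_const_zero, add_zero]
    rw [← Finset.card_filter, card_half ends r hreg]

theorem cut_ge (ends : ε → Sym2 V) (lam : ℕ) (hlam : 1 ≤ lam) (hconn : MEdgeConnected ends lam)
    (P : Finset V) (D : Finset ε) (hD : D.Nonempty)
    (hDP : ∀ e, e ∈ D ↔ ∃ a ∈ P, ∃ b ∉ P, ends e = s(a, b)) : lam ≤ D.card := by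
  by_contra hlt
  obtain ⟨e, he⟩ := hD
  obtain ⟨a, ha, b, hb, -⟩ := (hDP e).1 he
  have hw := hconn D (by omega) a b
  have : b ∈ P := by
    clear hb
    induction hw with
    | refl => exact ha
    | tail _ hs ih =>
      obtain ⟨e', he', hee⟩ := hs
      by_contra hc
      exact (Finset.mem_sdiff.1 he').2 ((hDP e').2 ⟨_, ih, _, hc, hee⟩)
  exact hb this

theorem gw_cut (ends : ε → Sym2 V) (hl : ∀ e, ¬ (ends e).IsDiag) (r k m lam lamS : ℕ)
    (hkm : k + m = r) (hm : Even m) (hm0 : 0 < m) (hlam : 1 ≤ lam)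
    (hlamS : Odd lamS) (hlamS' : lamS = lam ∨ lamS = lam + 1) (hrk : r ≤ k * lamS)
    (hconn : MEdgeConnected ends lam) (hreg : MRegular ends r)
    (C : Finset (HalfE ends ⊕ (V × Fin m))) (hC : Odd C.card) :
    r ≤ ∑ x ∈ C, ∑ y ∈ Cᶜ, gw ends k m x y := by
  classical
  by_cases hcase : ∃ (v : V) (i j : Fin m), Sum.inr (v, i) ∈ C ∧ Sum.inr (v, j) ∉ C
  · obtain ⟨v, i, j, hi, hj⟩ := hcase
    let f : {a : HalfE ends // a.1.1 = v} →
        (HalfE ends ⊕ (V × Fin m)) × (HalfE ends ⊕ (V × Fin m)) := fun a =>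
      if Sum.inl a.1 ∈ C then (Sum.inl a.1, Sum.inr (v, j)) else (Sum.inr (v, i), Sum.inl a.1)
    have hf : Function.Injective f := by
      intro a b hab
      simp only [f] at hab
      apply Subtype.ext
      split_ifs at hab <;> simpa using hab
    have := sum_le_cut (gw ends k m) C f hf
      (by intro a; simp only [f]; split_ifs <;> simp_all)
      (by intro a; simp only [f]; split_ifs <;> simp_all)
    refine le_trans ?_ this
    have h1 : ∀ a, gw ends k m (f a).1 (f a).2 = 1 := by
      intro a; simp only [f]; split_ifs <;> simp [gw, a.2]
    simp only [h1, Finset.sum_const, smul_eq_mul, mul_one, Finset.card_univ]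
    rw [Fintype.card_subtype, card_half ends r hreg]
  have huni : ∀ (v : V) (i j : Fin m), Sum.inr (v, i) ∈ C → Sum.inr (v, j) ∈ C := by
    intro v i j hi
    by_contra hj
    exact hcase ⟨v, i, j, hi, hj⟩
  let i0 : Fin m := ⟨0, hm0⟩
  have hB : Even C.toRight.card := by
    rw [Finset.card_eq_sum_card_fiberwise (f := Prod.fst) (t := Finset.univ) (by simp [Set.MapsTo])]
    apply Finset.even_sum
    intro v _
    by_cases hv : Sum.inr (v, i0) ∈ C
    · have : C.toRight.filter (fun p => p.1 = v) =
          Finset.univ.image (fun i : Fin m => (v, i)) := by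
        ext ⟨x, i⟩
        simp only [Finset.mem_filter, Finset.mem_toRight, Finset.mem_image, Finset.mem_univ,
          true_and, Prod.mk.injEq]
        constructor
        · rintro ⟨_, rfl⟩
          exact ⟨i, rfl, rfl⟩
        · rintro ⟨j, rfl, rfl⟩
          exact ⟨huni _ i0 _ hv, rfl⟩
      rw [this, Finset.card_image_of_injective _ (Prod.mk_right_injective v)]
      simpa using hm
    · have : C.toRight.filter (fun p => p.1 = v) = ∅ := by
        ext ⟨x, i⟩
        simp only [Finset.mem_filter, Finset.mem_toRight, Finset.notMem_empty, iff_false]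
        rintro ⟨h, rfl⟩
        exact hv (huni _ _ _ h)
      simp [this]
  have hA : Odd C.toLeft.card := by
    rw [← Finset.card_toLeft_add_card_toRight] at hC
    exact (Nat.odd_add.1 hC).2 hB
  let Spl : Finset ε :=
    Finset.univ.filter fun e => Odd (C.toLeft.filter fun a => a.1.2 = e).card
  have hSodd : Odd Spl.card := by
    rw [Finset.card_eq_sum_card_fiberwise (f := fun a : HalfE ends => a.1.2)
      (t := Finset.univ) (by simp [Set.MapsTo]), Finset.odd_sum_iff_odd_card_odd] at hA
    exact hA
  have hSpl : ∀ e, e ∈ Spl ↔ ∃ a a' : HalfE ends, a.1.2 = e ∧ a'.1.2 = e ∧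
      Sum.inl a ∈ C ∧ Sum.inl a' ∉ C := by
    intro e
    simp only [Spl, Finset.mem_filter, Finset.mem_univ, true_and]
    constructor
    · intro ho
      obtain ⟨a, ha⟩ := Finset.card_pos.1 ho.pos
      simp only [Finset.mem_filter, Finset.mem_toLeft] at ha
      obtain ⟨a', h1, h2, h3⟩ := exists_other ends hl a
      refine ⟨a, a', ha.2, h1.trans ha.2, ha.1, fun hc => ?_⟩
      have : C.toLeft.filter (fun a => a.1.2 = e) = {a, a'} := by
        ext c
        simp only [Finset.mem_filter, Finset.mem_toLeft, Finset.mem_insert, Finset.mem_singleton]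
        constructor
        · rintro ⟨_, h⟩
          exact h3 c (h.trans ha.2.symm)
        · rintro (rfl | rfl)
          · exact ha
          · exact ⟨hc, h1.trans ha.2⟩
      rw [this, Finset.card_pair h2.symm] at ho
      exact absurd ho (by decide)
    · rintro ⟨a, a', ha, ha', hC1, hC2⟩
      obtain ⟨a'', h1, h2, h3⟩ := exists_other ends hl a
      have hne : a' ≠ a := by rintro rfl; exact hC2 hC1
      have : a'' = a' := ((h3 a' (ha'.trans ha.symm)).resolve_left hne).symm
      subst this
      have : C.toLeft.filter (fun a => a.1.2 = e) = {a} := by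
        ext c
        simp only [Finset.mem_filter, Finset.mem_toLeft, Finset.mem_singleton]
        constructor
        · rintro ⟨hc, h⟩
          rcases h3 c (h.trans ha.symm) with h | h
          · exact h
          · exact absurd (h ▸ hc) hC2
        · rintro rfl
          exact ⟨hC1, ha⟩
      rw [this]
      simp
  haveI : Nonempty (HalfE ends) := by
    obtain ⟨e, he⟩ := Finset.card_pos.1 hSodd.pos
    obtain ⟨a, -⟩ := (hSpl e).1 he
    exact ⟨a⟩
  choose! p q hp hq hpC hqC using fun e => (hSpl e).1
  have hpq : ∀ e ∈ Spl, p e ≠ q e := fun e he h => hqC e he (h ▸ hpC e he)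
  have hwpq : ∀ e ∈ Spl, gw ends k m (Sum.inl (p e)) (Sum.inl (q e)) = k := by
    intro e he
    simp [gw, hp e he, hq e he, hpq e he]
  have hpinj : ∀ e ∈ Spl, ∀ e' ∈ Spl, p e = p e' → e = e' := by
    intro e he e' he' h
    rw [← hp e he, ← hp e' he', h]
  by_cases hdev : ∃ a : HalfE ends, ¬ (Sum.inl a ∈ C ↔ Sum.inr (a.1.1, i0) ∈ C)
  · obtain ⟨a, ha⟩ := hdev
    let f : Spl ⊕ Fin m →
        (HalfE ends ⊕ (V × Fin m)) × (HalfE ends ⊕ (V × Fin m)) := fun t =>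
      match t with
      | .inl e => (Sum.inl (p e), Sum.inl (q e))
      | .inr i => if Sum.inl a ∈ C then (Sum.inl a, Sum.inr (a.1.1, i))
          else (Sum.inr (a.1.1, i), Sum.inl a)
    have hf : Function.Injective f := by
      rintro (e | i) (e' | i') h
      · simp only [f, Prod.mk.injEq, Sum.inl.injEq] at h
        rw [Subtype.ext (hpinj e.1 e.2 e'.1 e'.2 h.1)]
      · exfalso
        simp only [f] at h
        split_ifs at h <;> simp at h
      · exfalso
        simp only [f] at h
        split_ifs at h <;> simp at h
      · simp only [f] at h
        split_ifs at h <;> simpa using h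
    have hall : ∀ i, Sum.inr (a.1.1, i) ∈ C ↔ Sum.inr (a.1.1, i0) ∈ C :=
      fun i => ⟨huni _ _ _, huni _ _ _⟩
    have hcut := sum_le_cut (gw ends k m) C f hf
      (by
        rintro (e | i)
        · exact hpC e.1 e.2
        · simp only [f]
          split_ifs with h
          · exact h
          · rw [hall]; tauto)
      (by
        rintro (e | i)
        · exact hqC e.1 e.2
        · simp only [f]
          split_ifs with h
          · rw [hall]; tauto
          · exact h)
    refine le_trans ?_ hcut
    rw [Fintype.sum_sum_type]
    have e1 : ∑ e : Spl, gw ends k m (f (.inl e)).1 (f (.inl e)).2 = Spl.card * k := by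
      have : ∀ e : Spl, gw ends k m (f (.inl e)).1 (f (.inl e)).2 = k := fun e => hwpq e.1 e.2
      simp [this]
    have e2 : ∑ i : Fin m, gw ends k m (f (.inr i)).1 (f (.inr i)).2 = m := by
      have : ∀ i : Fin m, gw ends k m (f (.inr i)).1 (f (.inr i)).2 = 1 := by
        intro i
        simp only [f]
        split_ifs <;> simp [gw]
      simp [this]
    rw [e1, e2]
    have := hSodd.pos
    nlinarith
  · push Not at hdev
    let P : Finset V := Finset.univ.filter fun v => Sum.inr (v, i0) ∈ C
    have hP : ∀ a : HalfE ends, Sum.inl a ∈ C ↔ a.1.1 ∈ P := by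
      intro a; simp [P, hdev a]
    have hge : lam ≤ Spl.card := by
      refine cut_ge ends lam hlam hconn P Spl (Finset.card_pos.1 hSodd.pos) ?_
      intro e
      rw [hSpl]
      constructor
      · rintro ⟨a, a', rfl, ha', h1, h2⟩
        rw [hP] at h1 h2
        refine ⟨_, h1, _, h2, ?_⟩
        have hne : a.1.1 ≠ a'.1.1 := fun h => h2 (h ▸ h1)
        exact (Sym2.mem_and_mem_iff hne).1 ⟨a.2, ha' ▸ a'.2⟩
      · rintro ⟨x, hx, y, hy, he⟩
        refine ⟨⟨(x, e), by simp [he]⟩, ⟨(y, e), by simp [he]⟩, rfl, rfl, ?_, ?_⟩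
        · rw [hP]; exact hx
        · rw [hP]; exact hy
    have hge' : lamS ≤ Spl.card := by
      rcases hlamS' with h | h
      · omega
      · obtain ⟨s, hs⟩ := hlamS
        obtain ⟨t, ht⟩ := hSodd
        omega
    let f : Spl → (HalfE ends ⊕ (V × Fin m)) × (HalfE ends ⊕ (V × Fin m)) := fun e =>
      (Sum.inl (p e), Sum.inl (q e))
    have hf : Function.Injective f := by
      intro e e' h
      simp only [f, Prod.mk.injEq, Sum.inl.injEq] at h
      exact Subtype.ext (hpinj e.1 e.2 e'.1 e'.2 h.1)
    have hcut := sum_le_cut (gw ends k m) C f hf (fun e => hpC e.1 e.2) (fun e => hqC e.1 e.2)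
    refine le_trans ?_ hcut
    have e1 : ∑ e : Spl, gw ends k m (f e).1 (f e).2 = Spl.card * k := by
      have : ∀ e : Spl, gw ends k m (f e).1 (f e).2 = k := fun e => hwpq e.1 e.2
      simp [this]
    rw [e1]
    nlinarith

theorem factor_of_pm (ends : ε → Sym2 V) (hl : ∀ e, ¬ (ends e).IsDiag) (r k m : ℕ)
    (hkm : k + m = r) (hreg : MRegular ends r) (M : (gG ends k m).Subgraph)
    (hM : M.IsPerfectMatching) : HasKFactor ends k := by
  classical
  have hex : ∀ x, ∃! y, M.Adj x y := fun x => hM.1 (hM.2 x)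
  let F : Finset ε := Finset.univ.filter fun e =>
    ∃ a a' : HalfE ends, a.1.2 = e ∧ a'.1.2 = e ∧ M.Adj (Sum.inl a) (Sum.inl a')
  refine ⟨F, fun v => ?_⟩
  have hsub : ∀ x y, M.Adj x y → gw ends k m x y ≠ 0 := fun x y h => M.adj_sub h
  -- half-edges matched inside the vertex gadget
  let N : Finset (HalfE ends) := Finset.univ.filter fun a => a.1.1 = v ∧ a.1.2 ∉ F
  have hNin : ∀ a : HalfE ends, a.1.2 ∉ F ↔ ∃ i : Fin m, M.Adj (Sum.inl a) (Sum.inr (a.1.1, i)) := by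
    intro a
    obtain ⟨y, hy, huy⟩ := hex (Sum.inl a)
    constructor
    · intro hF
      rcases y with a' | ⟨x, i⟩
      · exfalso
        have h1 := hsub _ _ hy
        have h2 : a.1.2 = a'.1.2 := by
          by_contra h
          simp [gw, h] at h1
        exact hF (by simp only [F, Finset.mem_filter, Finset.mem_univ, true_and]
                     exact ⟨a, a', rfl, h2.symm, hy⟩)
      · have h1 := hsub _ _ hy
        have h2 : a.1.1 = x := by
          by_contra h
          simp [gw, h] at h1
        subst h2
        exact ⟨i, hy⟩
    · rintro ⟨i, hi⟩ hF
      simp only [F, Finset.mem_filter, Finset.mem_univ, true_and] at hF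
      obtain ⟨b, b', hb, hb', hbb⟩ := hF
      obtain ⟨a', h1, h2, h3⟩ := exists_other ends hl a
      have key : ∀ c, M.Adj (Sum.inl a) (Sum.inl c) → False := by
        intro c hc
        have := (huy _ hc).trans (huy _ hi).symm
        simp at this
      rcases h3 b hb with rfl | rfl
      · exact key _ hbb
      · rcases h3 b' hb' with rfl | rfl
        · exact key _ hbb.symm
        · exact hbb.ne rfl
  have hNcard : N.card = m := by
    have : Fintype.card (Fin m) = m := Fintype.card_fin m
    rw [← this, ← Finset.card_univ]
    symm
    have hB : ∀ i : Fin m, ∃ a : HalfE ends, a.1.1 = v ∧ M.Adj (Sum.inl a) (Sum.inr (v, i)) := by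
      intro i
      obtain ⟨y, hy, -⟩ := hex (Sum.inr (v, i))
      have h1 := hsub _ _ hy
      rcases y with a | b
      · refine ⟨a, ?_, hy.symm⟩
        by_contra h
        simp [gw, h] at h1
      · simp [gw] at h1
    choose g hg1 hg2 using hB
    refine Finset.card_bij (fun i _ => g i) ?_ ?_ ?_
    · intro i _
      simp only [N, Finset.mem_filter, Finset.mem_univ, true_and]
      refine ⟨hg1 i, (hNin _).2 ⟨i, ?_⟩⟩
      rw [hg1]; exact hg2 i
    · intro i _ j _ hij
      have h1 := hg2 i
      have h2 := hg2 j
      rw [← hij] at h2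
      have := (hex _).unique h1 h2
      simpa using this
    · intro a ha
      simp only [N, Finset.mem_filter, Finset.mem_univ, true_and] at ha
      obtain ⟨i, hi⟩ := (hNin a).1 ha.2
      rw [ha.1] at hi
      refine ⟨i, Finset.mem_univ _, ?_⟩
      have := (hex _).unique (hg2 i).symm hi.symm
      simpa using this
  have hdeg : mdegIn ends F v =
      (Finset.univ.filter fun a : HalfE ends => a.1.1 = v ∧ a.1.2 ∈ F).card := by
    symm
    rw [mdegIn]
    refine Finset.card_bij (fun a _ => a.1.2) ?_ ?_ ?_
    · rintro ⟨⟨x, e⟩, h⟩ hx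
      simp only [Finset.mem_filter, Finset.mem_univ, true_and] at hx h ⊢
      exact ⟨hx.2, hx.1 ▸ h⟩
    · rintro ⟨⟨x, e⟩, h⟩ hx ⟨⟨x', e'⟩, h'⟩ hx' he
      simp only [Finset.mem_filter, Finset.mem_univ, true_and] at hx hx' he
      exact Subtype.ext (Prod.ext (hx.1.trans hx'.1.symm) he)
    · intro e he
      rw [Finset.mem_filter] at he
      refine ⟨⟨(v, e), he.2⟩, ?_, rfl⟩
      rw [Finset.mem_filter]
      exact ⟨Finset.mem_univ _, rfl, he.1⟩
  have hsum := Finset.card_filter_add_card_filter_not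
    (s := Finset.univ.filter fun a : HalfE ends => a.1.1 = v) (fun a => a.1.2 ∈ F)
  rw [Finset.filter_filter, Finset.filter_filter, card_half ends r hreg] at hsum
  change _ + N.card = r at hsum
  rw [hdeg]
  omega

end Gadget

/-- Theorem 1(4) of the paper: let `r` and `k` be odd, `lam ≥ 1`, and let `lamS` be the odd
integer in `{lam, lam + 1}`.  If `r/lamS ≤ k ≤ r − 2`, then every `lam`-edge-connected
`r`-regular multigraph `G` with `k·|V(G)|` even has a `k`-factor. -/
theorem stmt_3 {V : Type} [Fintype V] [DecidableEq V] {ε : Type} [Fintype ε] [DecidableEq ε]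
    (ends : ε → Sym2 V) (hloopless : ∀ e, ¬ (ends e).IsDiag)
    (r k lam lamS : ℕ) (hr : Odd r) (hk : Odd k) (hlam : 1 ≤ lam)
    (hlamS : Odd lamS) (hlamS' : lamS = lam ∨ lamS = lam + 1)
    (hlow : (r : ℝ) / lamS ≤ k) (hhigh : k ≤ r - 2)
    (hconn : MEdgeConnected ends lam) (hreg : MRegular ends r)
    (heven : Even (k * Fintype.card V)) :
    HasKFactor ends k := by
  obtain ⟨a, ha⟩ := hr
  obtain ⟨b, hb⟩ := hk
  have hkm : k + (r - k) = r := by omega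
  have hlp : (0 : ℝ) < lamS := by
    have := hlamS.pos
    exact_mod_cast this
  have hrk : r ≤ k * lamS := by
    rw [div_le_iff₀ hlp] at hlow
    exact_mod_cast hlow
  obtain ⟨M, hM⟩ := exists_pm_of_weights (gG ends k (r - k)) (gw ends k (r - k)) r (by omega)
    (fun x y h => h) (gw_col ends hloopless r k (r - k) hkm hreg)
    (gw_cut ends hloopless r k (r - k) lam lamS hkm ⟨a - b, by omega⟩ (by omega) hlam hlamS
      hlamS' hrk hconn hreg)
  exact factor_of_pm ends hloopless r k (r - k) hkm hreg M hM
end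

section
/- Let H be a λ-edge-connected hypergraph and let B = B(X, Y) be the incidence graph of H, with X = V(H) and Y = E(H). Let R ⊆ V(B) with R ∩ X ≠ ∅, and let D be a connected component of B − R. Then the number of edges of B between R and D is at least λ, unless D consists of a single vertex y ∈ Y. -/
open Finset

/-- Lemma 2.1 of the paper: let `H` be a `lam`-edge-connected hypergraph and let
`B = B(X, Y)` be its incidence graph (on `V ⊕ ε`, with `X = V(H)` the left part and
`Y = E(H)` the right part).  Let `R ⊆ V(B)` with `R ∩ X ≠ ∅` and let `D` be a
connected component of `B − R`.  Then `e_B(R, D) ≥ lam` unless `D = {y}` for some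
`y ∈ Y`. -/
theorem stmt_7 {V : Type} [Fintype V] [DecidableEq V] {ε : Type} [Fintype ε] [DecidableEq ε]
    (edges : ε → Finset V) (hedge : ∀ e, 2 ≤ (edges e).card)
    (lam : ℕ) (hconn : HEdgeConnected edges lam)
    (R : Finset (V ⊕ ε)) (hR : ∃ v : V, Sum.inl v ∈ R)
    (D : Finset (V ⊕ ε))
    (hD : SIsComp (incGraph edges) ((Finset.univ : Finset (V ⊕ ε)) \ R) D)
    (hsingle : ∀ y : ε, D ≠ {Sum.inr y}) :
    lam ≤ eSG (incGraph edges) R D := by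
  classical
  obtain ⟨s, hs, hDdef⟩ := hD
  obtain ⟨r, hr⟩ := hR
  have memD : ∀ a, a ∈ D ↔ a ∉ R ∧ SReachIn (incGraph edges) (Finset.univ \ R) s a := by
    intro a
    rw [hDdef]
    simp
  have hsR : s ∉ R := by simpa using hs
  have hsD : s ∈ D := (memD s).2 ⟨hsR, Relation.ReflTransGen.refl⟩
  have hclosed : ∀ a b, a ∈ D → b ∉ R → (incGraph edges).Adj a b → b ∈ D := by
    intro a b ha hb hab
    obtain ⟨haR, har⟩ := (memD a).1 ha
    exact (memD b).2 ⟨hb, Relation.ReflTransGen.tail har ⟨by simpa using haR, by simpa using hb, hab⟩⟩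
  -- `D` contains a vertex of `H`
  have hx : ∃ x : V, Sum.inl x ∈ D := by
    by_contra hno
    push Not at hno
    obtain v | y := s
    · exact hno v hsD
    · apply hsingle y
      ext a
      rw [Finset.mem_singleton]
      constructor
      · intro ha
        obtain ⟨-, har⟩ := (memD a).1 ha
        rcases Relation.ReflTransGen.cases_head har with h | ⟨c, ⟨-, hc, hadj⟩, -⟩
        · exact h.symm
        · exfalso
          have hcD := hclosed _ _ hsD (by simpa using hc) hadj
          rcases hadj with ⟨v, e, h1, -, -⟩ | ⟨v, e, -, h2, -⟩
          · cases h1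
          · subst h2
            exact hno v hcD
      · rintro rfl
        exact hsD
  obtain ⟨x, hx⟩ := hx
  by_contra hlt
  push Not at hlt
  let F : Finset ε := Finset.univ.filter fun e =>
    (∃ u ∈ edges e, Sum.inl u ∈ D) ∧ (∃ w ∈ edges e, Sum.inl w ∉ D)
  have hpair : ∀ e ∈ F, ∃ p : (V ⊕ ε) × (V ⊕ ε),
      p ∈ (R ×ˢ D).filter (fun p => (incGraph edges).Adj p.1 p.2) ∧
      (p.1 = Sum.inr e ∧ (∃ u, p.2 = Sum.inl u) ∨ p.2 = Sum.inr e ∧ (∃ u, p.1 = Sum.inl u)) := by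
    intro e he
    obtain ⟨-, ⟨u, hu, huD⟩, ⟨w, hw, hwD⟩⟩ := Finset.mem_filter.1 he
    by_cases heR : Sum.inr e ∈ R
    · refine ⟨(Sum.inr e, Sum.inl u), ?_, Or.inl ⟨rfl, u, rfl⟩⟩
      rw [Finset.mem_filter, Finset.mem_product]
      exact ⟨⟨heR, huD⟩, Or.inr ⟨u, e, rfl, rfl, hu⟩⟩
    · have heD : Sum.inr e ∈ D := hclosed _ _ huD heR (Or.inl ⟨u, e, rfl, rfl, hu⟩)
      have hwR : Sum.inl w ∈ R := by
        by_contra h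
        exact hwD (hclosed _ _ heD h (Or.inr ⟨w, e, rfl, rfl, hw⟩))
      refine ⟨(Sum.inl w, Sum.inr e), ?_, Or.inr ⟨rfl, w, rfl⟩⟩
      rw [Finset.mem_filter, Finset.mem_product]
      exact ⟨⟨hwR, heD⟩, Or.inl ⟨w, e, rfl, rfl, hw⟩⟩
  choose! f hf1 hf2 using hpair
  have hcard : F.card ≤ eSG (incGraph edges) R D := by
    unfold eSG
    refine (Finset.card_le_card_of_injOn f (fun e he => hf1 e he) ?_).trans (le_of_eq ?_)
    · intro e he e' he' hee
      have h1 := hf2 e he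
      have h2 := hf2 e' he'
      rw [hee] at h1
      rcases h1 with ⟨h1, u, h1'⟩ | ⟨h1, u, h1'⟩ <;> rcases h2 with ⟨h2, v, h2'⟩ | ⟨h2, v, h2'⟩
      · exact Sum.inr_injective (h1.symm.trans h2)
      · rw [h1] at h2'; cases h2'
      · rw [h1'] at h2; cases h2
      · exact Sum.inr_injective (h1.symm.trans h2)
    · congr
  obtain ⟨vs, es, ⟨-, -, hlen, hstep⟩, hhead, hlast⟩ := hconn F (by omega) x r
  have hall : ∀ i : ℕ, (hi : i < vs.length) → Sum.inl vs[i] ∈ D := by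
    intro i
    induction i with
    | zero =>
      intro hi
      have : vs[0] = x := by
        rw [List.head?_eq_getElem?, List.getElem?_eq_getElem hi] at hhead
        exact Option.some.inj hhead
      rw [this]
      exact hx
    | succ i ih =>
      intro hi
      obtain ⟨h1, h2, h3⟩ := hstep i (by omega) hi
      by_contra hcon
      have hnF : es[i] ∉ F := by simpa using h1
      exact hnF (Finset.mem_filter.2 ⟨Finset.mem_univ _, ⟨_, h2, ih (by omega)⟩, ⟨_, h3, hcon⟩⟩)
  have hrD : Sum.inl r ∈ D := by
    have hl : vs.length - 1 < vs.length := by omega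
    rw [List.getLast?_eq_getElem?, List.getElem?_eq_getElem hl] at hlast
    have := hall _ hl
    rwa [Option.some.inj hlast] at this
  exact ((memD _).1 hrD).1 hr
end

section
/- Let H be a hypergraph, let B = B(X, Y) be the incidence graph of H with X = V(H) and Y = E(H), and let k be a positive integer. Define g, f on V(B) by g(v) = k and f(v) = k for v ∈ X, and g(v) = −2N, f(v) = 2 for v ∈ Y, where N is a sufficiently large integer (e.g., N ≥ |E(H)|). Then H has a Berge k-factor if and only if B has a parity (g, f)-factor. -/
open Finset

section Helpers

variable {V : Type} [Fintype V] [DecidableEq V] {ε : Type} [Fintype ε] [DecidableEq ε]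

/-- Selecting from every hyperedge zero or two vertices, every vertex being selected `k` times. -/
def HasSel (edges : ε → Finset V) (k : ℕ) : Prop :=
  ∃ S : ε → Finset V, (∀ e, S e ⊆ edges e) ∧ (∀ e, (S e).card = 0 ∨ (S e).card = 2) ∧
    ∀ v, (Finset.univ.filter fun e => v ∈ S e).card = k

lemma berge_iff_sel (edges : ε → Finset V) (k : ℕ) :
    HasBergeKFactor edges k ↔ HasSel edges k := by
  constructor
  · rintro ⟨E', n, ends, φ, hd, hdeg, hsub⟩
    refine ⟨fun e => if h : e ∈ E' then (ends (φ.symm ⟨e, h⟩)).toFinset else ∅, ?_, ?_, ?_⟩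
    · intro e x hx
      by_cases h : e ∈ E'
      · simp only [h, dif_pos, Sym2.mem_toFinset] at hx
        have := hsub _ x hx
        simpa using this
      · simp [h] at hx
    · intro e
      by_cases h : e ∈ E'
      · right
        simp only [h, dif_pos]
        exact Sym2.card_toFinset_of_not_isDiag _ (hd _)
      · left
        simp [h]
    · intro v
      rw [← hdeg v]
      symm
      refine Finset.card_bij (fun g _ => (φ g).1) ?_ ?_ ?_
      · intro g hg
        simpa using hg
      · intro a _ b _ hab
        exact φ.injective (Subtype.ext hab)
      · intro e he
        by_cases h : e ∈ E'
        · refine ⟨φ.symm ⟨e, h⟩, ?_, by simp⟩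
          simpa [h] using he
        · simp [h] at he
  · rintro ⟨S, hS, hc, hdeg⟩
    have key : ∀ e : {e // e ∈ Finset.univ.filter fun e => (S e).card = 2},
        ∃ z : Sym2 V, ¬ z.IsDiag ∧ ∀ v, v ∈ z ↔ v ∈ S e.1 := by
      rintro ⟨e, he⟩
      have he2 : (S e).card = 2 := by simpa using he
      obtain ⟨x, y, hxy, h⟩ := Finset.card_eq_two.1 he2
      exact ⟨s(x, y), by simpa using hxy, by simp [h]⟩
    choose z hz1 hz2 using key
    let φ := (Finset.univ.filter fun e => (S e).card = 2).equivFin.symm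
    refine ⟨_, _, fun g => z (φ g), φ, fun g => hz1 _, ?_, ?_⟩
    · intro v
      rw [← hdeg v]
      refine Finset.card_bij (fun g _ => (φ g).1) ?_ ?_ ?_
      · intro g hg
        simpa [hz2] using hg
      · intro a _ b _ hab
        exact φ.injective (Subtype.ext hab)
      · intro e he
        have hv : v ∈ S e := by simpa using he
        have h2 : (S e).card = 2 := by
          rcases hc e with h | h
          · rw [Finset.card_eq_zero] at h
            simp [h] at hv
          · exact h
        refine ⟨φ.symm ⟨e, by simp [h2]⟩, ?_, by simp⟩
        simp [hz2, hv]
    · intro g x hx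
      exact hS _ ((hz2 _ _).1 hx)

lemma mem_incGraph_edgeSet (edges : ε → Finset V) (x : Sym2 (V ⊕ ε))
    (hx : x ∈ (incGraph edges).edgeSet) :
    ∃ v e, x = s(Sum.inl v, Sum.inr e) ∧ v ∈ edges e := by
  induction x using Sym2.ind with
  | _ a b =>
    rw [SimpleGraph.mem_edgeSet] at hx
    rcases hx with ⟨v, e, rfl, rfl, h⟩ | ⟨v, e, rfl, rfl, h⟩
    · exact ⟨v, e, rfl, h⟩
    · exact ⟨v, e, Sym2.eq_swap, h⟩

lemma card_inl (edges : ε → Finset V) (F : Finset (Sym2 (V ⊕ ε)))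
    (hF : ∀ x ∈ F, x ∈ (incGraph edges).edgeSet) (v : V) :
    (F.filter fun x => Sum.inl v ∈ x).card =
      (Finset.univ.filter fun e : ε => s(Sum.inl v, Sum.inr e) ∈ F).card := by
  symm
  refine Finset.card_bij (fun e _ => s(Sum.inl v, Sum.inr e)) ?_ ?_ ?_
  · intro e he
    simpa using he
  · intro a _ b _ h
    simpa using h
  · intro x hx
    rw [Finset.mem_filter] at hx
    obtain ⟨u, e, rfl, -⟩ := mem_incGraph_edgeSet edges x (hF x hx.1)
    have : v = u := by simpa using hx.2
    subst this
    exact ⟨e, by simpa using hx.1, rfl⟩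

lemma card_inr (edges : ε → Finset V) (F : Finset (Sym2 (V ⊕ ε)))
    (hF : ∀ x ∈ F, x ∈ (incGraph edges).edgeSet) (e : ε) :
    (F.filter fun x => Sum.inr e ∈ x).card =
      (Finset.univ.filter fun v : V => s(Sum.inl v, Sum.inr e) ∈ F).card := by
  symm
  refine Finset.card_bij (fun v _ => s(Sum.inl v, Sum.inr e)) ?_ ?_ ?_
  · intro v hv
    simpa using hv
  · intro a _ b _ h
    simpa using h
  · intro x hx
    rw [Finset.mem_filter] at hx
    obtain ⟨u, e', rfl, -⟩ := mem_incGraph_edgeSet edges x (hF x hx.1)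
    have : e = e' := by simpa using hx.2
    subst this
    exact ⟨u, by simpa using hx.1, rfl⟩

end Helpers

/-- Lemma 2.3 of the paper: let `H` be a hypergraph, `B` its incidence graph on `V ⊕ ε`
(`X = V(H)` left, `Y = E(H)` right) and `k` a positive integer.  With
`g = k` on `X`, `g = −2N` on `Y`, `f = k` on `X`, `f = 2` on `Y` (where `N` is
sufficiently large, e.g. `N ≥ |E(H)|`), the hypergraph `H` has a Berge `k`-factor iff
`B` has a parity `(g, f)`-factor. -/
theorem stmt_9 {V : Type} [Fintype V] [DecidableEq V] {ε : Type} [Fintype ε] [DecidableEq ε]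
    (edges : ε → Finset V) (hedge : ∀ e, 2 ≤ (edges e).card)
    (k : ℕ) (hk : 0 < k) (N : ℤ) (hN : (Fintype.card ε : ℤ) ≤ N) :
    HasBergeKFactor edges k ↔
      HasParityFactorSG (incGraph edges)
        (Sum.elim (fun _ : V => (k : ℤ)) (fun _ : ε => -2 * N))
        (Sum.elim (fun _ : V => (k : ℤ)) (fun _ : ε => 2)) := by
  rw [berge_iff_sel]
  have hN0 : 0 ≤ N := le_trans (by positivity) hN
  constructor
  · rintro ⟨S, hS, hc, hdeg⟩
    let F : Finset (Sym2 (V ⊕ ε)) :=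
      (Finset.univ.filter fun p : V × ε => p.1 ∈ S p.2).image
        fun p => s(Sum.inl p.1, Sum.inr p.2)
    have hmem : ∀ v e, s(Sum.inl v, Sum.inr e) ∈ F ↔ v ∈ S e := by
      intro v e
      simp [F]
    have hF : ∀ x ∈ F, x ∈ (incGraph edges).edgeSet := by
      intro x hx
      simp only [F, Finset.mem_image, Finset.mem_filter, Finset.mem_univ, true_and] at hx
      obtain ⟨⟨v, e⟩, hp, rfl⟩ := hx
      rw [SimpleGraph.mem_edgeSet]
      exact Or.inl ⟨v, e, rfl, rfl, hS e hp⟩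
    refine ⟨F, hF, ?_⟩
    rintro (v | e)
    · rw [card_inl edges F hF v]
      simp only [hmem, hdeg, Sum.elim_inl]
      exact ⟨le_rfl, le_rfl, rfl⟩
    · rw [card_inr edges F hF e]
      simp only [hmem, Sum.elim_inr, Finset.filter_univ_mem]
      rcases hc e with h | h <;> rw [h]
      · exact ⟨by push_cast; linarith, by norm_num, by decide⟩
      · exact ⟨by push_cast; linarith, by norm_num, by decide⟩
  · rintro ⟨F, hF, h⟩
    refine ⟨fun e => Finset.univ.filter fun v : V => s(Sum.inl v, Sum.inr e) ∈ F, ?_, ?_, ?_⟩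
    · intro e v hv
      have hv' : s(Sum.inl v, Sum.inr e) ∈ F := by simpa using hv
      obtain ⟨u, e', heq, hu⟩ := mem_incGraph_edgeSet edges _ (hF _ hv')
      have : v = u ∧ e = e' := by simpa using heq
      obtain ⟨rfl, rfl⟩ := this
      exact hu
    · intro e
      have he := h (Sum.inr e)
      rw [card_inr edges F hF e] at he
      obtain ⟨-, h1, h2⟩ := he
      simp only [Sum.elim_inr] at h1 h2
      unfold Int.ModEq at h2
      beta_reduce
      omega
    · intro v
      have hv := h (Sum.inl v)
      rw [card_inl edges F hF v] at hv
      simp only [Sum.elim_inl] at hv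
      simp only [Finset.mem_filter, Finset.mem_univ, true_and]
      omega
end

section
/- Let r, t, m be integers with r ≥ 2, t ≥ 3 and m ≥ 2. Define the hypergraph H with V(H) = ℤ/tmℤ and edge multiset E(H) = ⋃_{i=0}^{r−1} E_i, where E_i = { e_{i,j} : 0 ≤ j ≤ m−1 } and e_{i,j} = { i + jt + l : 0 ≤ l ≤ t−1 } (so each E_i partitions V(H)). Then H is a t-uniform r-regular hypergraph and H is r-edge-connected. -/
open Finset

namespace S15

section berge
variable {V : Type} {ε : Type}

lemma berge_step (edges : ε → Finset V) (E' : Finset ε) (u x w : V) (e : ε) (he : e ∈ E')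
    (hx : x ∈ edges e) (hw : w ∈ edges e)
    (h : ∃ vs es, IsBergePath edges E' vs es ∧ vs.head? = some u ∧ vs.getLast? = some x) :
    ∃ vs es, IsBergePath edges E' vs es ∧ vs.head? = some u ∧ vs.getLast? = some w := by
  classical
  obtain ⟨vs, es, ⟨hvn, hen, hlen, hP⟩, hu, hl⟩ := h
  have hex : ∃ i, ∃ hi : i < vs.length, vs[i] ∈ edges e := by
    have hne : vs ≠ [] := by rintro rfl; simp at hlen
    refine ⟨vs.length - 1, by omega, ?_⟩
    rw [List.getLast?_eq_getElem?, List.getElem?_eq_getElem (by omega)] at hl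
    simp only [Option.some.injEq] at hl
    rw [hl]; exact hx
  obtain ⟨hi, hmem⟩ := Nat.find_spec hex
  have hmin : ∀ k, k < Nat.find hex → ∀ hk : k < vs.length, vs[k] ∉ edges e := by
    intro k hk hk' hc
    exact Nat.find_min hex hk ⟨hk', hc⟩
  generalize Nat.find hex = i at hi hmem hmin
  have hhead : (vs.take (i+1)).head? = some u := by
    rw [List.head?_take]; simpa using hu
  have hlast : (vs.take (i+1)).getLast? = some vs[i] := by
    rw [List.getLast?_eq_getElem?, List.length_take, min_eq_left (by omega)]
    simp [hi]
  have htn : (vs.take (i+1)).Nodup := hvn.sublist (List.take_sublist _ _)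
  have hten : (es.take i).Nodup := hen.sublist (List.take_sublist _ _)
  by_cases hwi : w = vs[i]
  · refine ⟨vs.take (i+1), es.take i, ⟨htn, hten, ?_, ?_⟩, hhead, by rw [hlast, hwi]⟩
    · simp only [List.length_take]; omega
    · intro k hk hk'
      simp only [List.length_take] at hk hk'
      simp only [List.getElem_take]
      exact hP k (by omega) (by omega)
  · refine ⟨vs.take (i+1) ++ [w], es.take i ++ [e], ⟨?_, ?_, ?_, ?_⟩, ?_, ?_⟩
    · rw [List.nodup_append]
      refine ⟨htn, by simp, ?_⟩
      intro a ha b hb hab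
      simp only [List.mem_singleton] at hb
      subst hab; subst hb
      obtain ⟨k, hk, hka⟩ := List.mem_iff_getElem.1 ha
      simp only [List.length_take] at hk
      simp only [List.getElem_take] at hka
      rcases Nat.lt_or_ge k i with h1 | h1
      · exact hmin k h1 (by omega) (hka ▸ hw)
      · have : k = i := by omega
        subst this
        exact hwi hka.symm
    · rw [List.nodup_append]
      refine ⟨hten, by simp, ?_⟩
      intro a ha b hb hab
      simp only [List.mem_singleton] at hb
      subst hab; subst hb
      obtain ⟨k, hk, hka⟩ := List.mem_iff_getElem.1 ha
      simp only [List.length_take] at hk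
      simp only [List.getElem_take] at hka
      have := (hP k (by omega) (by omega)).2.1
      rw [hka] at this
      exact hmin k (by omega) (by omega) this
    · simp only [List.length_append, List.length_take, List.length_singleton]; omega
    · intro k hk hk'
      simp only [List.length_append, List.length_take, List.length_singleton] at hk hk'
      rcases Nat.lt_or_ge k i with h1 | h1
      · have e1 : (es.take i ++ [e])[k]'(by simp; omega) = es[k]'(by omega) := by
          rw [List.getElem_append_left (by simp; omega)]; simp
        have e2 : (vs.take (i+1) ++ [w])[k]'(by simp; omega) = vs[k]'(by omega) := by
          rw [List.getElem_append_left (by simp; omega)]; simp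
        have e3 : (vs.take (i+1) ++ [w])[k+1]'(by simp; omega) = vs[k+1]'(by omega) := by
          rw [List.getElem_append_left (by simp; omega)]; simp
        rw [e1, e2, e3]
        exact hP k (by omega) (by omega)
      · have hki : k = i := by omega
        subst hki
        have e1 : (es.take k ++ [e])[k]'(by simp; omega) = e := by
          rw [List.getElem_append_right (by simp)]; simp
        have e2 : (vs.take (k+1) ++ [w])[k]'(by simp; omega) = vs[k]'(by omega) := by
          rw [List.getElem_append_left (by simp; omega)]; simp
        have e3 : (vs.take (k+1) ++ [w])[k+1]'(by simp; omega) = w := by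
          rw [List.getElem_append_right (by simp)]; simp
        rw [e1, e2, e3]
        exact ⟨he, hmem, hw⟩
    · rw [List.head?_append, hhead]; rfl
    · simp

end berge

lemma bad_card (r t : ℕ) (hr : 2 ≤ r) (ht : 3 ≤ t) (c : ZMod t) :
    (univ.filter fun i : Fin r => ((i : ℕ) : ZMod t) = c).card ≤
    (univ.filter fun i : Fin r => ¬ ((i : ℕ) : ZMod t) = c).card := by
  have key : ∀ a b : ℕ, (a : ZMod t) = c → (b : ZMod t) = c → a < b → a + t ≤ b := by
    intro a b ha hb hab
    have h : a ≡ b [MOD t] := (ZMod.natCast_eq_natCast_iff _ _ _).1 (ha.trans hb.symm)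
    have h2 := (Nat.modEq_iff_dvd' hab.le).1 h
    have := Nat.le_of_dvd (by omega) h2
    omega
  refine Finset.card_le_card_of_injOn
    (fun i => if h : (i : ℕ) + 1 < r then ⟨i + 1, h⟩ else ⟨i - 1, by omega⟩) ?_ ?_
  · intro i hi
    simp only [coe_filter, mem_univ, true_and, Set.mem_setOf_eq] at hi ⊢
    intro hc
    split_ifs at hc with h
    · have := key _ _ hi hc (by simp); simp at this; omega
    · have := key _ _ hc hi (by simp; omega); simp at this; omega
  · intro a ha b hb hab
    simp only [coe_filter, mem_univ, true_and, Set.mem_setOf_eq] at ha hb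
    have h1 := key a b ha hb
    have h2 := key b a hb ha
    have := a.2
    have := b.2
    apply Fin.ext
    dsimp only at hab
    split_ifs at hab <;> simp only [Fin.mk.injEq] at hab <;> omega

lemma exists_boundary (n : ℕ) [NeZero n] (S : ZMod n → Prop) (u v : ZMod n) (hu : S u)
    (hv : ¬ S v) : ∃ x, S x ∧ ¬ S (x + 1) := by
  by_contra! h
  have : ∀ k : ℕ, S (u + k) := by
    intro k
    induction k with
    | zero => simpa using hu
    | succ k ih => have := h _ ih; push_cast; rwa [← add_assoc]
  have := this (v - u).val
  rw [ZMod.natCast_zmod_val] at this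
  exact hv (by simpa using this)

section main
variable (r t m : ℕ) [NeZero (t * m)]

/-- index of the block of the `i`-th partition containing `v` -/
def blk (i : ℕ) (v : ZMod (t * m)) : ℕ := (v - (i : ZMod (t * m))).val / t

/-- residue mod `t` -/
def res (v : ZMod (t * m)) : ZMod t := ZMod.castHom (Dvd.intro m rfl) (ZMod t) v

lemma res_val (v : ZMod (t * m)) (i : ℕ) :
    (((v - (i : ZMod (t * m))).val : ℕ) : ZMod t) = res t m v - i := by
  have : res t m v - i = ZMod.castHom (Dvd.intro m rfl) (ZMod t) (v - (i : ZMod (t * m))) := by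
    rw [map_sub, map_natCast]; rfl
  rw [this]
  conv_rhs => rw [← ZMod.natCast_zmod_val (v - (i : ZMod (t * m)))]
  rw [map_natCast]

lemma blk_lt (ht : 0 < t) (i : ℕ) (v : ZMod (t * m)) : blk t m i v < m := by
  unfold blk
  rw [Nat.div_lt_iff_lt_mul ht]
  exact lt_of_lt_of_eq (ZMod.val_lt _) (mul_comm t m)

lemma mem_blk (ht : 0 < t) (i j : ℕ) (hj : j < m) (v : ZMod (t * m)) :
    (v ∈ (Finset.range t).image fun l => ((i + j * t + l : ℕ) : ZMod (t * m))) ↔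
      blk t m i v = j := by
  simp only [mem_image, mem_range]
  unfold blk
  constructor
  · rintro ⟨l, hl, rfl⟩
    have h1 : ((i + j * t + l : ℕ) : ZMod (t * m)) - (i : ZMod (t * m)) = ((j * t + l : ℕ) : ZMod (t*m)) := by
      push_cast; ring
    have h2 : j * t + l < t * m := by nlinarith
    rw [h1, ZMod.val_cast_of_lt h2, add_comm, Nat.add_mul_div_right _ _ ht, Nat.div_eq_of_lt hl]
    simp
  · intro h
    refine ⟨(v - (i : ZMod (t * m))).val % t, Nat.mod_lt _ ht, ?_⟩
    have := Nat.div_add_mod (v - (i : ZMod (t * m))).val t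
    rw [h] at this
    rw [add_assoc, mul_comm j t, this]
    push_cast
    rw [ZMod.natCast_zmod_val]; ring

lemma blk_succ (ht : 0 < t) (i : ℕ) (x : ZMod (t * m)) (h : ¬ ((i : ℕ) : ZMod t) = res t m x + 1) :
    blk t m i (x + 1) = blk t m i x := by
  have hnd : ¬ t ∣ (x - (i : ZMod (t * m))).val + 1 := by
    intro hd
    rw [← ZMod.natCast_eq_zero_iff] at hd
    push_cast at hd
    rw [res_val] at hd
    apply h
    linear_combination -hd
  have hlt := ZMod.val_lt (x - (i : ZMod (t * m)))
  have hlt2 : (x - (i : ZMod (t * m))).val + 1 < t * m := by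
    rcases Nat.lt_or_ge ((x - (i : ZMod (t * m))).val + 1) (t * m) with h | h
    · exact h
    · exact absurd ⟨m, by omega⟩ hnd
  have e : x + 1 - (i : ZMod (t * m)) = (((x - (i : ZMod (t * m))).val + 1 : ℕ) : ZMod (t * m)) := by
    push_cast
    rw [ZMod.natCast_zmod_val]; ring
  unfold blk
  rw [e, ZMod.val_cast_of_lt hlt2, Nat.succ_div, if_neg hnd]
  rfl

lemma blk_ne (i : ℕ) (x y : ZMod (t * m)) (hxy : x ≠ y) (h : res t m x = res t m y) :
    blk t m i x ≠ blk t m i y := by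
  intro hb
  apply hxy
  have hm : (x - (i : ZMod (t * m))).val % t = (y - (i : ZMod (t * m))).val % t := by
    have : (((x - (i : ZMod (t * m))).val : ℕ) : ZMod t) = ((y - (i : ZMod (t * m))).val : ℕ) := by
      rw [res_val, res_val, h]
    exact (ZMod.natCast_eq_natCast_iff _ _ _).1 this
  unfold blk at hb
  have h1 := Nat.div_add_mod (x - (i : ZMod (t * m))).val t
  have h2 := Nat.div_add_mod (y - (i : ZMod (t * m))).val t
  rw [hb, hm, h2] at h1
  have := ZMod.val_injective _ h1
  simpa using this.symm

end main

end S15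

open S15 in
theorem stmt_15 (r t m : ℕ) [NeZero (t * m)] (hr : 2 ≤ r) (ht : 3 ≤ t) (hm : 2 ≤ m)
    (edges : Fin r × Fin m → Finset (ZMod (t * m)))
    (hedges : ∀ p : Fin r × Fin m, edges p =
      (Finset.range t).image fun l => (((p.1 : ℕ) + (p.2 : ℕ) * t + l : ℕ) : ZMod (t * m))) :
    (∀ p, (edges p).card = t) ∧
    (∀ v : ZMod (t * m), hdeg edges v = r) ∧
    HEdgeConnected edges r := by
  have ht0 : 0 < t := by omega
  have hmem : ∀ p v, v ∈ edges p ↔ blk t m p.1 v = p.2 := by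
    intro p v
    rw [hedges, mem_blk t m ht0 _ _ p.2.2]
  -- the block of `v` in the `i`-th partition, as an edge index
  let B : ZMod (t * m) → Fin r → Fin r × Fin m := fun v i => (i, ⟨blk t m i v, blk_lt t m ht0 i v⟩)
  have hBinj : ∀ v, Function.Injective (B v) := fun v a b h => congrArg Prod.fst h
  have hBmem : ∀ v i, v ∈ edges (B v i) := fun v i => (hmem _ _).2 rfl
  refine ⟨?_, ?_, ?_⟩
  · intro p
    rw [hedges, card_image_of_injOn, card_range]
    intro a ha b hb hab
    simp only [coe_range, Set.mem_Iio] at ha hb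
    push_cast at hab
    have hab := add_left_cancel hab
    have h1 : t ≤ t * m := Nat.le_mul_of_pos_right _ (by omega)
    have := congrArg ZMod.val hab
    rwa [ZMod.val_cast_of_lt (by omega), ZMod.val_cast_of_lt (by omega)] at this
  · intro v
    unfold hdeg
    have : (univ.filter fun e => v ∈ edges e) = univ.image (B v) := by
      ext p
      simp only [mem_filter, mem_univ, true_and, mem_image, hmem]
      constructor
      · intro h
        exact ⟨p.1, Prod.ext rfl (Fin.ext h)⟩
      · rintro ⟨i, rfl⟩
        rfl
    rw [this, card_image_of_injective _ (hBinj v)]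
    simp
  · intro F hF u v
    by_contra hv
    let S : ZMod (t * m) → Prop := fun v => ∃ vs es, IsBergePath edges (univ \ F) vs es ∧
      vs.head? = some u ∧ vs.getLast? = some v
    have hSu : S u := ⟨[u], [], ⟨by simp, by simp, by simp, by simp⟩, by simp, by simp⟩
    have hSv : ¬ S v := hv
    have hcross : ∀ p a b, a ∈ edges p → b ∈ edges p → S a → ¬ S b → p ∈ F := by
      intro p a b ha hb hSa hSb
      by_contra hp
      exact hSb (berge_step edges _ u a b p (by simp [hp]) ha hb hSa)
    obtain ⟨x, hx, hx1⟩ := exists_boundary _ S u v hSu hSv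
    obtain ⟨y, hy, hy1⟩ := exists_boundary _ (fun z => ¬ S z) v u hSv (by simpa using hSu)
    simp only [not_not] at hy1
    have hxy : x ≠ y := by rintro rfl; exact hy hx
    have hB1 : ∀ z (i : Fin r), ¬ ((i : ℕ) : ZMod t) = res t m z + 1 → z + 1 ∈ edges (B z i) := by
      intro z i h
      rw [hmem]
      exact blk_succ t m ht0 i z h
    have hFx : ∀ i : Fin r, ¬ ((i : ℕ) : ZMod t) = res t m x + 1 → B x i ∈ F := fun i h =>
      hcross _ _ _ (hBmem x i) (hB1 x i h) hx hx1
    have hFy : ∀ i : Fin r, ¬ ((i : ℕ) : ZMod t) = res t m y + 1 → B y i ∈ F := fun i h =>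
      hcross _ _ _ (hB1 y i h) (hBmem y i) hy1 hy
    have hge : r ≤ F.card := by
      by_cases hres : res t m x = res t m y
      · let G := univ.filter fun i : Fin r => ¬ ((i : ℕ) : ZMod t) = res t m x + 1
        have hbad := bad_card r t hr ht (res t m x + 1)
        have hsum := Finset.card_filter_add_card_filter_not (s := (univ : Finset (Fin r)))
          (fun i : Fin r => ((i : ℕ) : ZMod t) = res t m x + 1)
        rw [card_univ, Fintype.card_fin] at hsum
        have hdisj : Disjoint (G.image (B x)) (G.image (B y)) := by
          rw [Finset.disjoint_left]
          intro p hp hq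
          obtain ⟨i, -, rfl⟩ := mem_image.1 hp
          obtain ⟨j, -, hj⟩ := mem_image.1 hq
          have hij : j = i := congrArg Prod.fst hj
          subst hij
          have := congrArg (fun q => (q.2 : ℕ)) hj
          exact blk_ne t m j x y hxy hres this.symm
        have hsub : G.image (B x) ∪ G.image (B y) ⊆ F := by
          intro p hp
          rcases mem_union.1 hp with hp | hp
          · obtain ⟨i, hi, rfl⟩ := mem_image.1 hp
            exact hFx i (mem_filter.1 hi).2
          · obtain ⟨i, hi, rfl⟩ := mem_image.1 hp
            exact hFy i (hres ▸ (mem_filter.1 hi).2)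
        have := card_le_card hsub
        rw [card_union_of_disjoint hdisj, card_image_of_injective _ (hBinj x),
          card_image_of_injective _ (hBinj y)] at this
        change G.card + G.card ≤ _ at this
        change _ ≤ G.card at hbad
        change _ + G.card = _ at hsum
        omega
      · have : univ ⊆ F.image Prod.fst := by
          intro i _
          rw [mem_image]
          by_cases h : ((i : ℕ) : ZMod t) = res t m x + 1
          · refine ⟨B y i, hFy i ?_, rfl⟩
            intro h'
            exact hres (add_right_cancel (h.symm.trans h'))
          · exact ⟨B x i, hFx i h, rfl⟩
        have h1 := card_le_card this
        rw [card_univ, Fintype.card_fin] at h1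
        exact h1.trans card_image_le
    omega
end
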